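/- Let G be a connected Δ-regular finite simple graph of order n with Δ ≥ 3 satisfying (Δ−1)·Z(G) = (Δ−2)·n + 2. Then G is isomorphic to the complete graph K_{Δ+1} or to the complete bipartite graph K_{Δ,Δ}. -/

import Mathlib

/-- The zero forcing closure: `v` eventually becomes colored starting from `S`,
under the rule that a colored vertex all of whose other neighbors are colored
forces its remaining neighbor to become colored. -/
inductive SimpleGraph.ZeroForces {V : Type*} (G : SimpleGraph V) (S : Set V) : V → Prop
  | init {v : V} (hv : v ∈ S) : SimpleGraph.ZeroForces G S v
  | force {u w : V} (hu : SimpleGraph.ZeroForces G S u) (hadj : G.Adj u w)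
      (hall : ∀ v, G.Adj u v → v ≠ w → SimpleGraph.ZeroForces G S v) :
      SimpleGraph.ZeroForces G S w

/-- `S` is a zero forcing set of `G` if every vertex eventually becomes colored. -/
def SimpleGraph.IsZeroForcingSet {V : Type*} (G : SimpleGraph V) (S : Set V) : Prop :=
  ∀ v, G.ZeroForces S v

/-- The zero forcing number of `G`: minimum cardinality of a zero forcing set. -/
noncomputable def SimpleGraph.zeroForcingNumber {V : Type*} (G : SimpleGraph V) : ℕ :=
  sInf {n | ∃ S : Set V, G.IsZeroForcingSet S ∧ S.ncard = n}

namespace SimpleGraph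

variable {V : Type*} {G : SimpleGraph V}

theorem ZeroForces.mono {S T : Set V} (hST : S ⊆ T) {v : V} (h : G.ZeroForces S v) :
    G.ZeroForces T v := by
  induction h with
  | init hv => exact .init (hST hv)
  | force _ hadj _ ihu ihall => exact .force ihu hadj ihall

theorem zeroForcingNumber_le {S : Set V} (hS : G.IsZeroForcingSet S) :
    G.zeroForcingNumber ≤ S.ncard :=
  Nat.sInf_le ⟨S, hS, rfl⟩

theorem Connected.eq_univ_of_adj_closed [Fintype V] (hconn : G.Connected) {C : Finset V}
    (hne : C.Nonempty) (hC : ∀ a ∈ C, ∀ b, G.Adj a b → b ∈ C) : C = Finset.univ := by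
  obtain ⟨a, ha⟩ := hne
  refine Finset.eq_univ_of_forall fun b => ?_
  obtain ⟨p⟩ := hconn.preconnected a b
  induction p with
  | nil => exact ha
  | cons h _ ih => exact ih (hC _ ha _ h)

/-- `S` forces every vertex of the nonempty set `C`, and `C` induces a subgraph without
isolated vertices. -/
structure IsForcedCluster (G : SimpleGraph V) (S C : Finset V) : Prop where
  forces : ∀ v ∈ C, G.ZeroForces (S : Set V) v
  nonempty : C.Nonempty
  exists_adj : ∀ v ∈ C, ∃ w ∈ C, G.Adj v w

/-- `C` is a forced cluster whose number of seeds attains the extremal ratio for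
`(d + 2)`-regular graphs. -/
def IsTightCluster (G : SimpleGraph V) (d : ℕ) (C : Finset V) : Prop :=
  ∃ S, G.IsForcedCluster S C ∧ (d + 1) * S.card = d * C.card + 2

theorem isTightCluster_pair [DecidableEq V] (d : ℕ) {u v : V} (h : G.Adj u v) :
    G.IsTightCluster d {u, v} := by
  refine ⟨{u, v}, ⟨fun w hw => .init (by exact_mod_cast hw), ⟨u, by simp⟩, ?_⟩, ?_⟩
  · intro w hw
    rcases Finset.mem_insert.1 hw with rfl | hw
    · exact ⟨v, by simp, h⟩
    · rw [Finset.mem_singleton.1 hw]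
      exact ⟨u, by simp, h.symm⟩
  · rw [Finset.card_pair h.ne]
    ring

variable [Fintype V] [DecidableEq V] [DecidableRel G.Adj] {d : ℕ}

theorem IsForcedCluster.extend {S C : Finset V} (h : G.IsForcedCluster S C) {v : V} (hv : v ∈ C)
    (hk : (G.neighborFinset v \ C).Nonempty) :
    ∃ T, G.IsForcedCluster T (C ∪ G.neighborFinset v) ∧
      T.card + 1 ≤ S.card + (G.neighborFinset v \ C).card := by
  obtain ⟨x, hx⟩ := hk
  set K := G.neighborFinset v \ C with hK
  set T := S ∪ K.erase x with hT
  have hST : (S : Set V) ⊆ T := by exact_mod_cast Finset.subset_union_left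
  have hforces : ∀ w, w ∈ C ∪ G.neighborFinset v → w ≠ x → G.ZeroForces (T : Set V) w := by
    intro w hw hwx
    by_cases hwC : w ∈ C
    · exact (h.forces w hwC).mono hST
    · refine .init ?_
      have : w ∈ T := by simp_all
      exact_mod_cast this
  refine ⟨T, ⟨fun w hw => ?_, h.nonempty.mono Finset.subset_union_left, fun w hw => ?_⟩, ?_⟩
  · by_cases hwx : w = x
    · subst hwx
      refine .force ((h.forces v hv).mono hST) (by simp_all) fun y hy hyw => ?_
      exact hforces y (by simp [hy]) hyw
    · exact hforces w hw hwx
  · by_cases hwC : w ∈ C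
    · obtain ⟨y, hy, hwy⟩ := h.exists_adj w hwC
      exact ⟨y, Finset.mem_union_left _ hy, hwy⟩
    · refine ⟨v, Finset.mem_union_left _ hv, ?_⟩
      have : G.Adj v w := by simp_all
      exact this.symm
  · have h1 : T.card ≤ S.card + (K.erase x).card := Finset.card_union_le _ _
    have h2 := Finset.card_erase_add_one hx
    omega

theorem card_compl_union_lt {C : Finset V} {v : V} (hk : (G.neighborFinset v \ C).Nonempty) :
    (C ∪ G.neighborFinset v)ᶜ.card < Cᶜ.card := by
  obtain ⟨x, hx⟩ := hk
  rw [Finset.mem_sdiff] at hx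
  exact Finset.card_lt_card <| (Finset.ssubset_iff_of_subset
    (Finset.compl_subset_compl.2 Finset.subset_union_left)).2 ⟨x, by simp [hx.2], by simp_all⟩

theorem card_union_neighborFinset (C : Finset V) (v : V) :
    (C ∪ G.neighborFinset v).card = C.card + (G.neighborFinset v \ C).card := by
  rw [← Finset.union_sdiff_self_eq_union, Finset.card_union_of_disjoint Finset.disjoint_sdiff]

theorem IsForcedCluster.card_neighborFinset_sdiff_le (hreg : G.IsRegularOfDegree (d + 2))
    {S C : Finset V} (h : G.IsForcedCluster S C) {v : V} (hv : v ∈ C) :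
    (G.neighborFinset v \ C).card ≤ d + 1 := by
  obtain ⟨w, hw, hvw⟩ := h.exists_adj v hv
  have hlt : (G.neighborFinset v \ C).card < (G.neighborFinset v).card :=
    Finset.card_lt_card <| (Finset.ssubset_iff_of_subset Finset.sdiff_subset).2
      ⟨w, by simpa using hvw, by simp [hw]⟩
  have hdeg : (G.neighborFinset v).card = d + 2 := hreg v
  omega

/-- Greedy extension: a lower bound for all zero forcing sets of a regular connected graph
passes to all forced clusters. -/
theorem IsForcedCluster.le_card (hreg : G.IsRegularOfDegree (d + 2)) (hconn : G.Connected)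
    (hlow : ∀ S : Finset V, G.IsZeroForcingSet (S : Set V) →
      d * Fintype.card V + 2 ≤ (d + 1) * S.card)
    {S C : Finset V} (h : G.IsForcedCluster S C) : d * C.card + 2 ≤ (d + 1) * S.card := by
  by_cases hC : C = Finset.univ
  · subst hC
    exact hlow S fun v => h.forces v (Finset.mem_univ v)
  · have : ∃ v ∈ C, (G.neighborFinset v \ C).Nonempty := by
      by_contra! hcon
      refine hC (hconn.eq_univ_of_adj_closed h.nonempty fun a ha b hab => ?_)
      have := Finset.sdiff_eq_empty_iff_subset.1 (hcon a ha)
      exact this (by simpa using hab)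
    obtain ⟨v, hv, hk⟩ := this
    obtain ⟨T, hT, hcard⟩ := h.extend hv hk
    have hdec := card_compl_union_lt hk
    have ih := hT.le_card hreg hconn hlow
    rw [card_union_neighborFinset] at ih
    have hle := h.card_neighborFinset_sdiff_le hreg hv
    nlinarith
termination_by Cᶜ.card
decreasing_by assumption

theorem IsTightCluster.card_neighborFinset_sdiff (hreg : G.IsRegularOfDegree (d + 2))
    (hconn : G.Connected)
    (hlow : ∀ S : Finset V, G.IsZeroForcingSet (S : Set V) →
      d * Fintype.card V + 2 ≤ (d + 1) * S.card)
    {C : Finset V} (h : G.IsTightCluster d C) {v : V} (hv : v ∈ C)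
    (hk : (G.neighborFinset v \ C).Nonempty) :
    (G.neighborFinset v \ C).card = d + 1 ∧ G.IsTightCluster d (C ∪ G.neighborFinset v) := by
  obtain ⟨S, hS, hcard⟩ := h
  obtain ⟨T, hT, hTS⟩ := hS.extend hv hk
  have hle := hS.card_neighborFinset_sdiff_le hreg hv
  have hge := hT.le_card hreg hconn hlow
  rw [card_union_neighborFinset] at hge
  have heq : (G.neighborFinset v \ C).card = d + 1 := by nlinarith
  refine ⟨heq, T, hT, ?_⟩
  rw [card_union_neighborFinset]
  rw [heq] at hge hTS ⊢
  nlinarith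

theorem IsTightCluster.union_neighborFinset (hreg : G.IsRegularOfDegree (d + 2))
    (hconn : G.Connected)
    (hlow : ∀ S : Finset V, G.IsZeroForcingSet (S : Set V) →
      d * Fintype.card V + 2 ≤ (d + 1) * S.card)
    {C : Finset V} (h : G.IsTightCluster d C) {v : V} (hv : v ∈ C) :
    G.IsTightCluster d (C ∪ G.neighborFinset v) := by
  by_cases hk : (G.neighborFinset v \ C).Nonempty
  · exact (h.card_neighborFinset_sdiff hreg hconn hlow hv hk).2
  · rw [Finset.not_nonempty_iff_eq_empty, Finset.sdiff_eq_empty_iff_subset] at hk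
    rwa [Finset.union_eq_left.2 hk]

theorem IsTightCluster.neighborFinset_subset (hreg : G.IsRegularOfDegree (d + 2))
    (hconn : G.Connected)
    (hlow : ∀ S : Finset V, G.IsZeroForcingSet (S : Set V) →
      d * Fintype.card V + 2 ≤ (d + 1) * S.card)
    {C : Finset V} (h : G.IsTightCluster d C) {v a b : V} (hv : v ∈ C) (ha : a ∈ C) (hb : b ∈ C)
    (hab : a ≠ b) (hva : G.Adj v a) (hvb : G.Adj v b) : G.neighborFinset v ⊆ C := by
  rw [← Finset.sdiff_eq_empty_iff_subset, ← Finset.not_nonempty_iff_eq_empty]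
  intro hk
  have heq := (h.card_neighborFinset_sdiff hreg hconn hlow hv hk).1
  have hsub : ({a, b} : Finset V) ⊆ G.neighborFinset v ∩ C := by
    intro x hx
    rcases Finset.mem_insert.1 hx with rfl | hx
    · simp [hva, ha]
    · rw [Finset.mem_singleton.1 hx]
      simp [hvb, hb]
  have h2 := Finset.card_le_card hsub
  rw [Finset.card_pair hab] at h2
  have hsum := Finset.card_sdiff_add_card_inter (G.neighborFinset v) C
  have hdeg : (G.neighborFinset v).card = d + 2 := hreg v
  omega

theorem eq_top_of_triangle (hreg : G.IsRegularOfDegree (d + 2)) (hconn : G.Connected)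
    (hlow : ∀ S : Finset V, G.IsZeroForcingSet (S : Set V) →
      d * Fintype.card V + 2 ≤ (d + 1) * S.card)
    {u v w : V} (huv : G.Adj u v) (huw : G.Adj u w) (hvw : G.Adj v w) :
    Fintype.card V = d + 3 ∧ G = ⊤ := by
  set C := insert u (G.neighborFinset u) with hC
  have hcardC : ∀ x, (insert x (G.neighborFinset x)).card = d + 3 := fun x => by
    rw [Finset.card_insert_of_notMem (by simp)]
    exact congrArg (· + 1) (hreg x)
  have htight : G.IsTightCluster d C := by
    have := (isTightCluster_pair d huv).union_neighborFinset hreg hconn hlow (v := u) (by simp)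
    convert this using 1
    ext x
    simp only [hC, Finset.mem_insert, mem_neighborFinset, Finset.mem_union, Finset.mem_singleton]
    grind
  have huC : u ∈ C := Finset.mem_insert_self _ _
  have hnC : ∀ {x}, G.Adj u x → x ∈ C := fun hx => by simp [hC, hx]
  have hvC : insert v (G.neighborFinset v) = C := by
    refine Finset.eq_of_subset_of_card_le (Finset.insert_subset (hnC huv) ?_)
      (by rw [hcardC, hcardC])
    exact htight.neighborFinset_subset hreg hconn hlow (hnC huv) huC (hnC huw) huw.ne
      huv.symm hvw
  have huniv : C = Finset.univ := by
    refine hconn.eq_univ_of_adj_closed ⟨u, huC⟩ fun a ha b hab => ?_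
    by_cases hau : a = u
    · exact hnC (hau ▸ hab)
    by_cases hav : a = v
    · rw [← hvC]
      subst hav
      simp [hab]
    have h1 : G.Adj a u := by
      have := ha
      simp only [hC, Finset.mem_insert, mem_neighborFinset, hau, false_or] at this
      exact this.symm
    have h2 : G.Adj a v := by
      have := ha
      simp only [← hvC, Finset.mem_insert, mem_neighborFinset, hav, false_or] at this
      exact this.symm
    exact htight.neighborFinset_subset hreg hconn hlow ha huC (hnC huv) huv.ne h1 h2
      (by simpa using hab)
  have hcard : Fintype.card V = d + 3 := by rw [← Finset.card_univ, ← huniv, hcardC]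
  refine ⟨hcard, ?_⟩
  ext a b
  refine ⟨fun h => h.ne, fun hab => ?_⟩
  have hall : insert a (G.neighborFinset a) = Finset.univ :=
    Finset.eq_univ_of_card _ (by rw [hcardC, hcard])
  have : b ∈ insert a (G.neighborFinset a) := hall ▸ Finset.mem_univ b
  simpa [Ne.symm hab] using this

theorem neighborFinset_eq_of_common (hreg : G.IsRegularOfDegree (d + 2)) (hconn : G.Connected)
    (hlow : ∀ S : Finset V, G.IsZeroForcingSet (S : Set V) →
      d * Fintype.card V + 2 ≤ (d + 1) * S.card)
    (htri : ∀ u v w, G.Adj u v → G.Adj u w → ¬ G.Adj v w)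
    {v w a b : V} (hab : a ≠ b) (hva : G.Adj v a) (hvb : G.Adj v b)
    (hwa : G.Adj w a) (hwb : G.Adj w b) : G.neighborFinset w = G.neighborFinset v := by
  have htight := ((isTightCluster_pair d hva).union_neighborFinset hreg hconn hlow
    (v := v) (by simp)).union_neighborFinset hreg hconn hlow (v := a) (by simp)
  have hsub := htight.neighborFinset_subset hreg hconn hlow (v := w) (a := a) (b := b)
    (by simp [hwa.symm]) (by simp) (by simp [hvb]) hab hwa hwb
  refine Finset.eq_of_subset_of_card_le (fun x hx => ?_) ?_
  · have hxC := hsub hx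
    rw [mem_neighborFinset] at hx
    simp only [Finset.mem_union, Finset.mem_insert, Finset.mem_singleton,
      mem_neighborFinset] at hxC ⊢
    rcases hxC with ((rfl | rfl) | h) | h
    · exact absurd hx (htri a w x hwa.symm hva.symm)
    · exact hva
    · exact h
    · exact absurd hx (htri a w x hwa.symm h)
  · exact ((hreg v).trans (hreg w).symm).le

theorem completeBipartite_of_common (hreg : G.IsRegularOfDegree (d + 2)) (hconn : G.Connected)
    (hlow : ∀ S : Finset V, G.IsZeroForcingSet (S : Set V) →
      d * Fintype.card V + 2 ≤ (d + 1) * S.card)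
    (htri : ∀ u v w, G.Adj u v → G.Adj u w → ¬ G.Adj v w)
    {v w u x : V} (hvw : v ≠ w) (hux : u ≠ x) (hvu : G.Adj v u) (hvx : G.Adj v x)
    (hwu : G.Adj w u) (hwx : G.Adj w x) :
    Nonempty (G ≃g completeBipartiteGraph (Fin (d + 2)) (Fin (d + 2))) := by
  have hxu : G.neighborFinset x = G.neighborFinset u :=
    neighborFinset_eq_of_common hreg hconn hlow htri hvw hvu.symm hwu.symm hvx.symm hwx.symm
  have hwv : G.neighborFinset w = G.neighborFinset v :=
    neighborFinset_eq_of_common hreg hconn hlow htri hux hvu hvx hwu hwx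
  have hleft : ∀ {a}, G.Adj u a → G.neighborFinset a = G.neighborFinset v := fun {a} ha => by
    have hxa : a ∈ G.neighborFinset x := by simpa [hxu] using ha
    exact neighborFinset_eq_of_common hreg hconn hlow htri hux hvu hvx ha.symm
      (by simpa [adj_comm] using hxa)
  have hright : ∀ {a}, G.Adj v a → G.neighborFinset a = G.neighborFinset u := fun {a} ha => by
    have hwa : a ∈ G.neighborFinset w := by simpa [hwv] using ha
    exact neighborFinset_eq_of_common hreg hconn hlow htri hvw hvu.symm hwu.symm ha.symm
      (by simpa [adj_comm] using hwa)
  have hLadj : ∀ {a b}, G.Adj u a → (G.Adj a b ↔ G.Adj v b) := fun {a b} ha => by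
    simpa using Finset.ext_iff.1 (hleft ha) b
  have hRadj : ∀ {a b}, G.Adj v a → (G.Adj a b ↔ G.Adj u b) := fun {a b} ha => by
    simpa using Finset.ext_iff.1 (hright ha) b
  have huniv : G.neighborFinset u ∪ G.neighborFinset v = Finset.univ := by
    refine hconn.eq_univ_of_adj_closed ⟨v, by simp [hvu.symm]⟩ fun a ha b hab => ?_
    simp only [Finset.mem_union, mem_neighborFinset] at ha ⊢
    rcases ha with ha | ha
    · exact .inr ((hLadj ha).1 hab)
    · exact .inl ((hRadj ha).1 hab)
  have hiff : ∀ a, G.Adj v a ↔ ¬ G.Adj u a := fun a => by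
    refine ⟨fun h1 h2 => htri v u a hvu h1 h2, fun h => ?_⟩
    have : a ∈ G.neighborFinset u ∪ G.neighborFinset v := huniv ▸ Finset.mem_univ a
    simpa [h] using this
  have hcardL : Fintype.card {a // G.Adj u a} = Fintype.card (Fin (d + 2)) := by
    rw [Fintype.card_fin, ← hreg u, ← card_neighborFinset_eq_degree, Fintype.card_subtype]
    congr 1
    ext
    simp
  have hcardR : Fintype.card {a // ¬ G.Adj u a} = Fintype.card (Fin (d + 2)) := by
    rw [Fintype.card_fin, ← hreg v, ← card_neighborFinset_eq_degree, Fintype.card_subtype]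
    congr 1
    ext
    simp [hiff]
  refine ⟨(RelIso.symm ⟨((Fintype.equivOfCardEq hcardL).symm.sumCongr
    (Fintype.equivOfCardEq hcardR).symm).trans (Equiv.sumCompl _), ?_⟩)⟩
  rintro (a | a) (b | b)
  · have hb := ((Fintype.equivOfCardEq hcardL).symm b).2
    simp [hLadj ((Fintype.equivOfCardEq hcardL).symm a).2, hiff, hb]
  · have hb := ((Fintype.equivOfCardEq hcardR).symm b).2
    simp [hLadj ((Fintype.equivOfCardEq hcardL).symm a).2, hiff, hb]
  · have ha := (hiff _).2 ((Fintype.equivOfCardEq hcardR).symm a).2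
    have hb := ((Fintype.equivOfCardEq hcardL).symm b).2
    simp [hRadj ha, hb]
  · have ha := (hiff _).2 ((Fintype.equivOfCardEq hcardR).symm a).2
    have hb := ((Fintype.equivOfCardEq hcardR).symm b).2
    simp [hRadj ha, hb]

/-- Without triangles and `4`-cycles, a tight cluster that is not closed under adjacency extends
to a larger one. -/
theorem IsTightCluster.exists_not_subset (hd : 1 ≤ d) (hreg : G.IsRegularOfDegree (d + 2))
    (hconn : G.Connected)
    (hlow : ∀ S : Finset V, G.IsZeroForcingSet (S : Set V) →
      d * Fintype.card V + 2 ≤ (d + 1) * S.card)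
    (htri : ∀ u v w, G.Adj u v → G.Adj u w → ¬ G.Adj v w)
    (hquad : ∀ v w u x, v ≠ w → u ≠ x → G.Adj v u → G.Adj v x → G.Adj w u → ¬ G.Adj w x)
    {C : Finset V} (h : G.IsTightCluster d C) {l x : V} (hl : l ∈ C) (hlx : G.Adj l x)
    (hx : x ∉ C) : ¬ G.neighborFinset x ⊆ C ∪ G.neighborFinset l := by
  intro hsub
  have hdeg : (G.neighborFinset x).card = d + 2 := hreg x
  obtain ⟨y, hy, hyl⟩ := Finset.exists_mem_ne (by omega : 1 < (G.neighborFinset x).card) l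
  have hyC : y ∈ C := by
    rcases Finset.mem_union.1 (hsub hy) with h | h
    · exact h
    · simp only [mem_neighborFinset] at h hy
      exact absurd hy (htri l x y hlx h)
  have hyx : G.Adj y x := by simpa [adj_comm] using hy
  have hk := (h.card_neighborFinset_sdiff hreg hconn hlow hyC ⟨x, by simp [hyx, hx]⟩).1
  obtain ⟨z, hz, hzx⟩ :=
    Finset.exists_mem_ne (by omega : 1 < (G.neighborFinset y \ C).card) x
  simp only [Finset.mem_sdiff, mem_neighborFinset] at hz
  obtain ⟨S, hS, -⟩ := id h
  obtain ⟨p, hp, hyp⟩ := hS.exists_adj y hyC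
  have hfull := (h.union_neighborFinset hreg hconn hlow hl).neighborFinset_subset hreg hconn hlow
    (v := y) (a := p) (b := x) (Finset.mem_union_left _ hyC) (Finset.mem_union_left _ hp)
    (by simp [hlx]) (fun e => hx (e ▸ hp)) hyp hyx
  have hlz : G.Adj l z := by
    have := hfull (by simpa using hz.1 : z ∈ G.neighborFinset y)
    simpa [hz.2] using this
  exact hquad l y x z (Ne.symm hyl) (Ne.symm hzx) hlx hlz hyx hz.1

theorem IsTightCluster.neighborFinset_subset_of_girth (hd : 1 ≤ d)
    (hreg : G.IsRegularOfDegree (d + 2)) (hconn : G.Connected)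
    (hlow : ∀ S : Finset V, G.IsZeroForcingSet (S : Set V) →
      d * Fintype.card V + 2 ≤ (d + 1) * S.card)
    (htri : ∀ u v w, G.Adj u v → G.Adj u w → ¬ G.Adj v w)
    (hquad : ∀ v w u x, v ≠ w → u ≠ x → G.Adj v u → G.Adj v x → G.Adj w u → ¬ G.Adj w x)
    {C : Finset V} (h : G.IsTightCluster d C) {l : V} (hl : l ∈ C) :
    G.neighborFinset l ⊆ C := by
  intro x hx
  by_contra hxC
  have hlx : G.Adj l x := by simpa using hx
  have hdec := card_compl_union_lt ⟨x, Finset.mem_sdiff.2 ⟨hx, hxC⟩⟩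
  exact h.exists_not_subset hd hreg hconn hlow htri hquad hl hlx hxC
    ((h.union_neighborFinset hreg hconn hlow hl).neighborFinset_subset_of_girth hd hreg hconn
      hlow htri hquad (Finset.mem_union_right _ hx))
termination_by Cᶜ.card
decreasing_by assumption

end SimpleGraph

/-- A connected `Δ`-regular graph of order `n` with `Δ ≥ 3` and
`(Δ−1)·Z(G) = (Δ−2)·n + 2` is isomorphic to `K_{Δ+1}` or to `K_{Δ,Δ}`. -/
theorem stmt16 {V : Type*} [Fintype V] (G : SimpleGraph V) [DecidableRel G.Adj]
    (n Δ : ℕ) (hn : Fintype.card V = n) (hΔ3 : 3 ≤ Δ)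
    (hreg : G.IsRegularOfDegree Δ) (hconn : G.Connected)
    (hZ : (Δ - 1) * G.zeroForcingNumber = (Δ - 2) * n + 2) :
    Nonempty (G ≃g (⊤ : SimpleGraph (Fin (Δ + 1)))) ∨
      Nonempty (G ≃g completeBipartiteGraph (Fin Δ) (Fin Δ)) := by
  classical
  obtain ⟨d, rfl⟩ : ∃ d, Δ = d + 2 := ⟨Δ - 2, by omega⟩
  have hlow : ∀ S : Finset V, G.IsZeroForcingSet (S : Set V) →
      d * Fintype.card V + 2 ≤ (d + 1) * S.card := fun S hS => by
    have hle := SimpleGraph.zeroForcingNumber_le hS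
    rw [Set.ncard_coe_finset] at hle
    have hZ' : (d + 1) * G.zeroForcingNumber = d * Fintype.card V + 2 := by
      rw [hn]
      simpa using hZ
    rw [← hZ']
    exact Nat.mul_le_mul_left _ hle
  by_cases htri : ∀ u v w, G.Adj u v → G.Adj u w → ¬ G.Adj v w
  swap
  · push Not at htri
    obtain ⟨u, v, w, huv, huw, hvw⟩ := htri
    obtain ⟨hcard, rfl⟩ := SimpleGraph.eq_top_of_triangle hreg hconn hlow huv huw hvw
    exact .inl ⟨SimpleGraph.Iso.completeGraph (Fintype.equivFinOfCardEq hcard)⟩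
  by_cases hquad : ∀ v w u x, v ≠ w → u ≠ x → G.Adj v u → G.Adj v x → G.Adj w u → ¬ G.Adj w x
  swap
  · push Not at hquad
    obtain ⟨v, w, u, x, hvw, hux, hvu, hvx, hwu, hwx⟩ := hquad
    exact .inr (SimpleGraph.completeBipartite_of_common hreg hconn hlow htri hvw hux hvu hvx
      hwu hwx)
  exfalso
  obtain ⟨u⟩ := hconn.nonempty
  have hdeg : (G.neighborFinset u).card = d + 2 := hreg u
  obtain ⟨v, hv⟩ : (G.neighborFinset u).Nonempty := Finset.card_pos.1 (by omega)
  have hsub := (SimpleGraph.isTightCluster_pair d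
    ((G.mem_neighborFinset u v).1 hv)).neighborFinset_subset_of_girth (by omega) hreg hconn hlow
    htri hquad (l := u) (by simp)
  have hsub' : G.neighborFinset u ⊆ {v} := fun y hy => by
    rcases Finset.mem_insert.1 (hsub hy) with rfl | h
    · simp at hy
    · exact h
  have := Finset.card_le_card hsub'
  rw [Finset.card_singleton] at this
  omega
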